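/- arXiv:1604.04579 — 14 statements merged into one kernel-verified Lean document; each statement's English description precedes it below -/
import Mathlib

section
/- Suppose T_r < (t + (P_d − P_A)·θ̄/C_B)·(P_A/P_d). Then the function T_s ↦ R_s(T_s, T_r) has a unique global maximizer over ℝ, namely T_s* = t + (P_d − P_A)·θ̄/C_B (best response of the fixed-power station, case (a) of Theorem 1). -/
/-- Revenue of the fixed-power charging station. -/
noncomputable def Rs (t θb CB PA Pd Ts Tr : ℝ) : ℝ :=
  if Ts ≤ (Pd / PA) * Tr then CB * (Ts - t) * Real.exp (-(CB * Ts) / (θb * Pd))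
  else CB * (Ts - t) * Real.exp (-(CB * (Ts - Tr)) / (θb * (Pd - PA)))

/-- The function `s ↦ (s - t) * exp (-(s - r) / a)` has its strict maximum at `t + a`. -/
lemma sub_mul_exp_neg_div_lt {a s t : ℝ} (r : ℝ) (ha : 0 < a) (hs : s ≠ t + a) :
    (s - t) * Real.exp (-(s - r) / a) < a * Real.exp (-(t + a - r) / a) := by
  have hu : (s - t) / a - 1 ≠ 0 := by
    intro h
    apply hs
    field_simp at h
    linarith
  have hlt := Real.add_one_lt_exp hu
  rw [sub_add_cancel, div_lt_iff₀ ha] at hlt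
  calc (s - t) * Real.exp (-(s - r) / a)
      < Real.exp ((s - t) / a - 1) * a * Real.exp (-(s - r) / a) :=
        mul_lt_mul_of_pos_right hlt (Real.exp_pos _)
    _ = a * (Real.exp ((s - t) / a - 1) * Real.exp (-(s - r) / a)) := by ring
    _ = a * Real.exp (-(t + a - r) / a) := by
        rw [← Real.exp_add]
        congr 2
        field_simp
        ring

/-- Best response of the fixed-power station, case (a) of Theorem 1:
if `Tr < (t + (Pd − PA)·θ̄/CB)·(PA/Pd)`, then `Ts* = t + (Pd − PA)·θ̄/CB` is the
unique global maximizer of `Ts ↦ Rs Ts Tr`. -/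
theorem stmt0 (t θb CB PA Pd Tr : ℝ) (ht : 0 < t) (hθ : 0 < θb) (hCB : 0 < CB)
    (hPA : 0 < PA) (hPd : PA < Pd)
    (hTr : Tr < (t + (Pd - PA) * θb / CB) * (PA / Pd)) :
    ∀ Ts : ℝ, Ts ≠ t + (Pd - PA) * θb / CB →
      Rs t θb CB PA Pd Ts Tr < Rs t θb CB PA Pd (t + (Pd - PA) * θb / CB) Tr := by
  intro Ts hTs
  have hd : 0 < Pd - PA := sub_pos.mpr hPd
  have hPd0 : 0 < Pd := hPA.trans hPd
  have hopt : ¬ t + (Pd - PA) * θb / CB ≤ Pd / PA * Tr := by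
    rw [not_le]
    calc Pd / PA * Tr < Pd / PA * ((t + (Pd - PA) * θb / CB) * (PA / Pd)) :=
          mul_lt_mul_of_pos_left hTr (by positivity)
      _ = t + (Pd - PA) * θb / CB := by field_simp
  have hexponent (x : ℝ) :
      -(CB * (x - Tr)) / (θb * (Pd - PA)) = -(x - Tr) / ((Pd - PA) * θb / CB) := by
    field_simp
  have hmax : CB * (Ts - t) * Real.exp (-(CB * (Ts - Tr)) / (θb * (Pd - PA))) <
      Rs t θb CB PA Pd (t + (Pd - PA) * θb / CB) Tr := by
    rw [Rs, if_neg hopt, hexponent, hexponent, add_sub_cancel_left, mul_assoc, mul_assoc]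
    exact mul_lt_mul_of_pos_left (sub_mul_exp_neg_div_lt Tr (by positivity) hTs) hCB
  by_cases hle : Ts ≤ Pd / PA * Tr
  · rw [Rs, if_pos hle]
    rcases le_or_gt t Ts with h | h
    · refine lt_of_le_of_lt ?_ hmax
      have hTs_le : Ts * PA ≤ Pd * Tr := by
        rwa [div_mul_eq_mul_div, le_div_iff₀ hPA] at hle
      refine mul_le_mul_of_nonneg_left (Real.exp_le_exp.mpr ?_)
        (mul_nonneg hCB.le (sub_nonneg.mpr h))
      rw [div_le_div_iff₀ (by positivity) (by positivity)]
      linarith [mul_le_mul_of_nonneg_left hTs_le (mul_pos hCB hθ).le]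
    · have hneg : CB * (Ts - t) * Real.exp (-(CB * Ts) / (θb * Pd)) < 0 :=
        mul_neg_of_neg_of_pos (mul_neg_of_pos_of_neg hCB (sub_neg.mpr h)) (Real.exp_pos _)
      refine hneg.trans ?_
      rw [Rs, if_neg hopt, add_sub_cancel_left]
      positivity
  · rw [Rs, if_neg hle]
    exact hmax
end

section
/- Suppose T_r > (t + P_d·θ̄/C_B)·(P_A/P_d). Then the function T_s ↦ R_s(T_s, T_r) has a unique global maximizer over ℝ, namely T_s* = t + P_d·θ̄/C_B (best response of the fixed-power station, case (b) of Theorem 1). -/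
/-- The profile `(x - t) * exp (-x / K)` is strictly maximized at `x = t + K`. -/
lemma sub_mul_exp_neg_div_lt_s1 {t K x : ℝ} (hK : 0 < K) (hx : x ≠ t + K) :
    (x - t) * Real.exp (-x / K) < K * Real.exp (-(t + K) / K) := by
  have hne : (x - t) / K - 1 ≠ 0 := fun h => hx <| by
    field_simp at h
    linarith
  have h : (x - t) / K < Real.exp ((x - t) / K - 1) := by
    simpa using Real.add_one_lt_exp hne
  have hexp : Real.exp (-(t + K) / K) = Real.exp ((x - t) / K - 1) * Real.exp (-x / K) := by
    rw [← Real.exp_add]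
    congr 1
    field_simp
    ring
  rw [hexp, ← mul_assoc]
  refine mul_lt_mul_of_pos_right ?_ (Real.exp_pos _)
  rwa [div_lt_iff₀' hK] at h

/-- Above the price threshold, the exponent of the competitive regime is the smaller one. -/
lemma competitive_exponent_le {θb CB PA Pd Ts Tr : ℝ} (hθ : 0 < θb) (hCB : 0 < CB)
    (hPA : 0 < PA) (hPd : PA < Pd) (hTs : Pd / PA * Tr ≤ Ts) :
    -(CB * (Ts - Tr)) / (θb * (Pd - PA)) ≤ -(CB * Ts) / (θb * Pd) := by
  have hPd0 : 0 < Pd := hPA.trans hPd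
  have hsub : 0 < Pd - PA := sub_pos.2 hPd
  have hle : Pd * Tr ≤ Ts * PA := by
    rwa [div_mul_eq_mul_div, div_le_iff₀ hPA] at hTs
  rw [div_le_div_iff₀ (by positivity) (by positivity)]
  nlinarith [mul_le_mul_of_nonneg_left hle (mul_pos hCB hθ).le]

/-- Best response of the fixed-power station, case (b) of Theorem 1:
if `Tr > (t + Pd·θ̄/CB)·(PA/Pd)`, then `Ts* = t + Pd·θ̄/CB` is the unique global
maximizer of `Ts ↦ Rs Ts Tr`. -/
theorem stmt1 (t θb CB PA Pd Tr : ℝ) (ht : 0 < t) (hθ : 0 < θb) (hCB : 0 < CB)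
    (hPA : 0 < PA) (hPd : PA < Pd)
    (hTr : Tr > (t + Pd * θb / CB) * (PA / Pd)) :
    ∀ Ts : ℝ, Ts ≠ t + Pd * θb / CB →
      Rs t θb CB PA Pd Ts Tr < Rs t θb CB PA Pd (t + Pd * θb / CB) Tr := by
  intro Ts hTs
  have hPd0 : 0 < Pd := hPA.trans hPd
  have hK : 0 < Pd * θb / CB := by positivity
  have hthr : t + Pd * θb / CB < Pd / PA * Tr := by
    rw [gt_iff_lt, ← mul_div_assoc, div_lt_iff₀ hPd0] at hTr
    rw [div_mul_eq_mul_div, lt_div_iff₀ hPA]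
    linarith
  have hexp (y : ℝ) : -(CB * y) / (θb * Pd) = -y / (Pd * θb / CB) := by
    field_simp
  have hmax : CB * (Ts - t) * Real.exp (-(CB * Ts) / (θb * Pd)) <
      Rs t θb CB PA Pd (t + Pd * θb / CB) Tr := by
    rw [Rs, if_pos hthr.le, hexp, hexp, add_sub_cancel_left, mul_assoc, mul_assoc]
    exact mul_lt_mul_of_pos_left (sub_mul_exp_neg_div_lt_s1 hK hTs) hCB
  by_cases h : Ts ≤ Pd / PA * Tr
  · rwa [Rs, if_pos h]
  · rw [Rs, if_neg h]
    have hpos : 0 ≤ Ts - t := by linarith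
    refine lt_of_le_of_lt ?_ hmax
    gcongr CB * (Ts - t) * Real.exp ?_
    exact competitive_exponent_le hθ hCB hPA hPd (not_le.1 h).le
end

section
/- Suppose (t + (P_d − P_A)·θ̄/C_B)·(P_A/P_d) ≤ T_r ≤ (t + P_d·θ̄/C_B)·(P_A/P_d). Then the function T_s ↦ R_s(T_s, T_r) has a unique global maximizer over ℝ, namely the corner point T_s* = (P_d/P_A)·T_r (best response of the fixed-power station, case (c) of Theorem 1). -/
/-- Strict comparison of `x ↦ (x - t) * exp (-x / a)` at `x` and at a point `S` lying
weakly between `x` and the peak `t + a`. -/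
theorem sub_mul_exp_lt {t a S x E E' : ℝ} (ha : 0 < a) (hS : t < S) (hx : x ≠ S)
    (hpeak : 0 ≤ (S - x) * (t + a - S)) (hE : E' = E + (x - S) / a) :
    (x - t) * Real.exp E < (S - t) * Real.exp E' := by
  have hexp : (x - S) / a + 1 < Real.exp ((x - S) / a) :=
    Real.add_one_lt_exp (div_ne_zero (sub_ne_zero.mpr hx) ha.ne')
  have hlin : x - t ≤ (S - t) * ((x - S) / a + 1) := by
    have h : (S - t) * ((x - S) / a + 1) - (x - t) = (S - x) * (t + a - S) / a := by
      field_simp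
      ring
    linarith [div_nonneg hpeak ha.le]
  have hlt : x - t < (S - t) * Real.exp ((x - S) / a) :=
    hlin.trans_lt (mul_lt_mul_of_pos_left hexp (sub_pos.mpr hS))
  calc (x - t) * Real.exp E < (S - t) * Real.exp ((x - S) / a) * Real.exp E :=
        mul_lt_mul_of_pos_right hlt (Real.exp_pos E)
    _ = (S - t) * Real.exp E' := by rw [hE, Real.exp_add]; ring

/-- Best response of the fixed-power station, case (c) of Theorem 1:
if `(t + (Pd − PA)·θ̄/CB)·(PA/Pd) ≤ Tr ≤ (t + Pd·θ̄/CB)·(PA/Pd)`, then the corner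
point `Ts* = (Pd/PA)·Tr` is the unique global maximizer of `Ts ↦ Rs Ts Tr`. -/
theorem stmt2 (t θb CB PA Pd Tr : ℝ) (ht : 0 < t) (hθ : 0 < θb) (hCB : 0 < CB)
    (hPA : 0 < PA) (hPd : PA < Pd)
    (hTr1 : (t + (Pd - PA) * θb / CB) * (PA / Pd) ≤ Tr)
    (hTr2 : Tr ≤ (t + Pd * θb / CB) * (PA / Pd)) :
    ∀ Ts : ℝ, Ts ≠ (Pd / PA) * Tr →
      Rs t θb CB PA Pd Ts Tr < Rs t θb CB PA Pd ((Pd / PA) * Tr) Tr := by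
  intro Ts hne
  have hPd0 : 0 < Pd := hPA.trans hPd
  have hD : 0 < Pd - PA := sub_pos.mpr hPd
  obtain ⟨S, hS⟩ : ∃ S, S = Pd / PA * Tr := ⟨_, rfl⟩
  have hTr : Tr = S * (PA / Pd) := by rw [hS]; field_simp
  have hratio : 0 < PA / Pd := div_pos hPA hPd0
  rw [← hS] at hne ⊢
  rw [hTr] at hTr1 hTr2
  have hlow := le_of_mul_le_mul_right hTr1 hratio
  have hupp := le_of_mul_le_mul_right hTr2 hratio
  have ha : 0 < Pd * θb / CB := by positivity
  have hb : 0 < (Pd - PA) * θb / CB := by positivity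
  have htS : t < S := by linarith
  simp only [Rs, ← hS, le_refl, if_true]
  split_ifs with hle
  · rw [mul_assoc, mul_assoc]
    refine mul_lt_mul_of_pos_left (sub_mul_exp_lt ha htS hne
      (mul_nonneg (by linarith) (by linarith)) ?_) hCB
    field_simp
    ring
  · rw [mul_assoc, mul_assoc]
    refine mul_lt_mul_of_pos_left (sub_mul_exp_lt hb htS hne
      (mul_nonneg_of_nonpos_of_nonpos (by linarith) (by linarith)) ?_) hCB
    rw [hTr]
    have hD0 := hD.ne'
    field_simp
    ring
end

section
/- Suppose T_s ≥ 0 and T_s ≤ −E_r·(P_d/P_A). Then R_r(T_r, T_s) ≤ 0 for every T_r ∈ ℝ, and R_r((P_A/P_d)·T_s, T_s) = 0; in particular T_r = (P_A/P_d)·T_s is a global maximizer of T_r ↦ R_r(T_r, T_s) (best response of the regulation station, case (a) of Theorem 2). -/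
/-- Revenue of the regulation-providing charging station. -/
noncomputable def Rr (θb CB PA Pd Er Ts Tr : ℝ) : ℝ :=
  if Tr < 0 then
    CB * (Tr + Er) * (1 - Real.exp (-(CB * (Ts - Tr)) / (θb * (Pd - PA))))
  else if Tr ≤ (PA / Pd) * Ts then
    CB * (Tr + Er) *
      (Real.exp (-(CB * Tr) / (θb * PA)) - Real.exp (-(CB * (Ts - Tr)) / (θb * (Pd - PA))))
  else 0

theorem margin_nonpos_of_le {PA Pd Er Ts Tr : ℝ} (hPA : 0 < PA) (hPd : PA < Pd)
    (hTs : Ts ≤ -Er * (Pd / PA)) (h : Tr ≤ (PA / Pd) * Ts) : Tr + Er ≤ 0 := by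
  have hPd0 : 0 < Pd := hPA.trans hPd
  have h1 : (PA / Pd) * Ts ≤ (PA / Pd) * (-Er * (Pd / PA)) := by gcongr
  have h2 : (PA / Pd) * (-Er * (Pd / PA)) = -Er := by field_simp
  linarith

theorem Rr_nonpos {θb CB PA Pd Er Ts : ℝ} (hθ : 0 < θb) (hCB : 0 < CB)
    (hPA : 0 < PA) (hPd : PA < Pd) (hTs0 : 0 ≤ Ts) (hTs : Ts ≤ -Er * (Pd / PA)) (Tr : ℝ) :
    Rr θb CB PA Pd Er Ts Tr ≤ 0 := by
  have hPd0 : 0 < Pd := hPA.trans hPd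
  have hd : 0 < Pd - PA := sub_pos.mpr hPd
  unfold Rr
  split_ifs with hneg hle
  · have hTr : Tr ≤ (PA / Pd) * Ts := hneg.le.trans (by positivity)
    refine mul_nonpos_of_nonpos_of_nonneg
      (mul_nonpos_of_nonneg_of_nonpos hCB.le (margin_nonpos_of_le hPA hPd hTs hTr)) ?_
    rw [sub_nonneg, Real.exp_le_one_iff, neg_div, neg_nonpos]
    have : 0 ≤ Ts - Tr := by linarith
    positivity
  · refine mul_nonpos_of_nonpos_of_nonneg
      (mul_nonpos_of_nonneg_of_nonpos hCB.le (margin_nonpos_of_le hPA hPd hTs hle)) ?_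
    rw [sub_nonneg, Real.exp_le_exp, neg_div, neg_div, neg_le_neg_iff,
      div_le_div_iff₀ (by positivity) (by positivity)]
    have h : Tr * Pd ≤ PA * Ts := by
      rwa [div_mul_eq_mul_div, le_div_iff₀ hPd0] at hle
    have := mul_le_mul_of_nonneg_left h (mul_pos hCB hθ).le
    linarith
  · exact le_rfl

theorem Rr_threshold_eq_zero {θb CB PA Pd Er Ts : ℝ} (hθ : 0 < θb)
    (hPA : 0 < PA) (hPd : PA < Pd) (hTs0 : 0 ≤ Ts) :
    Rr θb CB PA Pd Er Ts ((PA / Pd) * Ts) = 0 := by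
  have hPd0 : 0 < Pd := hPA.trans hPd
  have hd : Pd - PA ≠ 0 := (sub_pos.mpr hPd).ne'
  have h0 : ¬ (PA / Pd) * Ts < 0 := not_lt.mpr (by positivity)
  have h : -(CB * ((PA / Pd) * Ts)) / (θb * PA) =
      -(CB * (Ts - (PA / Pd) * Ts)) / (θb * (Pd - PA)) := by
    field_simp
  rw [Rr, if_neg h0, if_pos le_rfl, h, sub_self, mul_zero]

/-- Best response of the regulation station, case (a) of Theorem 2:
if `0 ≤ Ts ≤ −Er·(Pd/PA)` then the revenue is nonpositive everywhere, vanishes at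
`Tr = (PA/Pd)·Ts`, and in particular `Tr = (PA/Pd)·Ts` is a global maximizer. -/
theorem stmt3 (t θb CB PA Pd Er Ts : ℝ) (ht : 0 < t) (hθ : 0 < θb) (hCB : 0 < CB)
    (hPA : 0 < PA) (hPd : PA < Pd)
    (hTs0 : 0 ≤ Ts) (hTs : Ts ≤ -Er * (Pd / PA)) :
    (∀ Tr : ℝ, Rr θb CB PA Pd Er Ts Tr ≤ 0) ∧
    Rr θb CB PA Pd Er Ts ((PA / Pd) * Ts) = 0 ∧
    (∀ Tr : ℝ, Rr θb CB PA Pd Er Ts Tr ≤ Rr θb CB PA Pd Er Ts ((PA / Pd) * Ts)) := by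
  have h := Rr_nonpos hθ hCB hPA hPd hTs0 hTs
  have h0 := Rr_threshold_eq_zero (CB := CB) (Er := Er) hθ hPA hPd hTs0
  exact ⟨h, h0, fun Tr => (h Tr).trans h0.ge⟩
end

section
/- Suppose T_s > 0 and E_r > −(P_A/P_d)·T_s. Then the left derivative at T_r = (P_A/P_d)·T_s of the function T_r ↦ R_r(T_r, T_s) is strictly negative; that is, ∂R_r/∂T_r < 0 at the upper boundary of the positive-revenue region. -/
/-- If `Ts > 0` and `Er > −(PA/Pd)·Ts`, the left derivative of `Tr ↦ Rr Tr Ts` at the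
upper boundary `Tr = (PA/Pd)·Ts` of the positive-revenue region is strictly negative. -/
theorem stmt8 (t θb CB PA Pd Er Ts : ℝ) (ht : 0 < t) (hθ : 0 < θb) (hCB : 0 < CB)
    (hPA : 0 < PA) (hPd : PA < Pd) (hTs : 0 < Ts)
    (hEr : Er > -(PA / Pd) * Ts) :
    ∃ d : ℝ, d < 0 ∧
      HasDerivWithinAt (fun Tr => Rr θb CB PA Pd Er Ts Tr) d
        (Set.Iic ((PA / Pd) * Ts)) ((PA / Pd) * Ts) := by
  have hPd0 : 0 < Pd := hPA.trans hPd
  have hsub : 0 < Pd - PA := sub_pos.mpr hPd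
  have hb : 0 < PA / Pd * Ts := by positivity
  have hE : 0 < PA / Pd * Ts + Er := by linarith
  have hexp : -(CB * (Ts - PA / Pd * Ts)) / (θb * (Pd - PA))
      = -(CB * (PA / Pd * Ts)) / (θb * PA) := by
    field_simp
  set b := PA / Pd * Ts
  set u := Real.exp (-(CB * b) / (θb * PA)) with hu
  have hlin : HasDerivAt (fun x : ℝ => CB * (x + Er)) (CB * 1) b :=
    ((hasDerivAt_id b).add_const Er).const_mul CB
  have hfst : HasDerivAt (fun x : ℝ => Real.exp (-(CB * x) / (θb * PA)))
      (u * (-(CB * 1) / (θb * PA))) b :=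
    ((((hasDerivAt_id b).const_mul CB).neg).div_const (θb * PA)).exp
  have hsnd : HasDerivAt (fun x : ℝ => Real.exp (-(CB * (Ts - x)) / (θb * (Pd - PA))))
      (u * (-(CB * (-1)) / (θb * (Pd - PA)))) b := by
    rw [hu, ← hexp]
    exact (((((hasDerivAt_id b).const_sub Ts).const_mul CB).neg).div_const _).exp
  have hprod := (hlin.mul (hfst.sub hsnd)).hasDerivWithinAt (s := Set.Iic b)
  refine ⟨-(CB * (b + Er) * (u * (CB / (θb * PA) + CB / (θb * (Pd - PA))))), ?_, ?_⟩
  · have : 0 < u := Real.exp_pos _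
    rw [neg_lt_zero]
    positivity
  · refine (hprod.congr_of_eventuallyEq_of_mem ?_ Set.self_mem_Iic).congr_deriv ?_
    · filter_upwards [self_mem_nhdsWithin, mem_nhdsWithin_of_mem_nhds (Ioi_mem_nhds hb)]
        with x hx hx0
      simp only [Rr]
      rw [if_neg (not_lt.mpr (le_of_lt hx0)), if_pos (Set.mem_Iic.mp hx)]
      rfl
    · simp only [Pi.sub_apply, hexp, ← hu]
      ring
end

section
/- Suppose T_s ≥ 0, E_r ≠ 0 and −E_r < (P_A/P_d)·T_s. Then the function T_r ↦ R_r(T_r, T_s) is differentiable at T_r = −E_r, and its derivative there is strictly positive. -/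
/-- At the zero `-E` of the linear factor, the derivative of `C * (x + E) * g x` is `C * g (-E)`. -/
theorem hasDerivAt_mul_add_mul (C E : ℝ) {g : ℝ → ℝ} (hg : DifferentiableAt ℝ g (-E)) :
    HasDerivAt (fun x => C * (x + E) * g x) (C * g (-E)) (-E) := by
  have h := (((hasDerivAt_id (-E)).add_const E).const_mul C).mul hg.hasDerivAt
  refine h.congr_deriv ?_
  simp

/-- If `Ts ≥ 0`, `Er ≠ 0` and `−Er < (PA/Pd)·Ts`, then `Tr ↦ Rr Tr Ts` is differentiable
at `Tr = −Er` with strictly positive derivative. -/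
theorem stmt9 (t θb CB PA Pd Er Ts : ℝ) (ht : 0 < t) (hθ : 0 < θb) (hCB : 0 < CB)
    (hPA : 0 < PA) (hPd : PA < Pd) (hTs : 0 ≤ Ts)
    (hEr : Er ≠ 0) (hlt : -Er < (PA / Pd) * Ts) :
    ∃ d : ℝ, 0 < d ∧ HasDerivAt (fun Tr => Rr θb CB PA Pd Er Ts Tr) d (-Er) := by
  have hD : 0 < θb * (Pd - PA) := mul_pos hθ (sub_pos.mpr hPd)
  rcases lt_or_gt_of_ne hEr with hneg | hpos
  · refine ⟨_, ?_, (hasDerivAt_mul_add_mul CB Er (g := fun Tr =>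
      Real.exp (-(CB * Tr) / (θb * PA)) -
        Real.exp (-(CB * (Ts - Tr)) / (θb * (Pd - PA)))) (by fun_prop)).congr_of_eventuallyEq ?_⟩
    · refine mul_pos hCB (sub_pos.mpr (Real.exp_lt_exp.mpr ?_))
      have hlt' : -Er * Pd < PA * Ts := by
        rwa [div_mul_eq_mul_div, lt_div_iff₀ (hPA.trans hPd)] at hlt
      rw [div_lt_div_iff₀ hD (mul_pos hθ hPA)]
      have := mul_pos (mul_pos hCB hθ) (sub_pos.mpr hlt')
      linarith
    · filter_upwards [lt_mem_nhds (neg_pos.mpr hneg), gt_mem_nhds hlt] with x hx0 hx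
      simp only [Rr, if_neg hx0.not_gt, if_pos hx.le]
  · refine ⟨_, ?_, (hasDerivAt_mul_add_mul CB Er (g := fun Tr =>
      1 - Real.exp (-(CB * (Ts - Tr)) / (θb * (Pd - PA))))
        (by fun_prop)).congr_of_eventuallyEq ?_⟩
    · refine mul_pos hCB (sub_pos.mpr (Real.exp_lt_one_iff.mpr (div_neg_of_neg_of_pos ?_ hD)))
      exact neg_neg_of_pos (mul_pos hCB (by linarith))
    · filter_upwards [gt_mem_nhds (neg_neg_of_pos hpos)] with x hx
      simp only [Rr, if_pos hx]
end

section
/- Suppose T_s ≥ 0. Then the function T_r ↦ R_r(T_r, T_s) is differentiable at every T_r < 0 with derivative D(T_r) = C_B·(1 − exp(−C_B·(T_s − T_r)/(θ̄·(P_d − P_A)))·(1 + C_B·(T_r + E_r)/(θ̄·(P_d − P_A)))); moreover, if E_r > 0, this derivative function D is strictly decreasing on the interval (−E_r, 0). -/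
/-- For `Ts ≥ 0`, the revenue `Tr ↦ Rr Tr Ts` is differentiable at every `Tr < 0` with
derivative `D(Tr) = CB·(1 − exp(−CB(Ts−Tr)/(θ̄(Pd−PA)))·(1 + CB(Tr+Er)/(θ̄(Pd−PA))))`;
moreover, if `Er > 0`, this derivative function is strictly decreasing on `(−Er, 0)`. -/
theorem stmt10 (t θb CB PA Pd Er Ts : ℝ) (ht : 0 < t) (hθ : 0 < θb) (hCB : 0 < CB)
    (hPA : 0 < PA) (hPd : PA < Pd) (hTs : 0 ≤ Ts) :
    (∀ Tr : ℝ, Tr < 0 →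
      HasDerivAt (fun x => Rr θb CB PA Pd Er Ts x)
        (CB * (1 - Real.exp (-(CB * (Ts - Tr)) / (θb * (Pd - PA))) *
          (1 + CB * (Tr + Er) / (θb * (Pd - PA))))) Tr) ∧
    (0 < Er → StrictAntiOn
      (fun Tr => CB * (1 - Real.exp (-(CB * (Ts - Tr)) / (θb * (Pd - PA))) *
        (1 + CB * (Tr + Er) / (θb * (Pd - PA)))))
      (Set.Ioo (-Er) 0)) := by
  have hk : 0 < θb * (Pd - PA) := mul_pos hθ (sub_pos.2 hPd)
  refine ⟨fun Tr hTr => ?_, fun _ x hx y _ hxy => ?_⟩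
  · have hexp : HasDerivAt (fun x => Real.exp (-(CB * (Ts - x)) / (θb * (Pd - PA))))
        (Real.exp (-(CB * (Ts - Tr)) / (θb * (Pd - PA))) *
          (-(CB * (-1)) / (θb * (Pd - PA)))) Tr :=
      ((((hasDerivAt_id' Tr).const_sub Ts).const_mul CB).fun_neg.div_const _).exp
    have hlin : HasDerivAt (fun x => CB * (x + Er)) (CB * 1) Tr :=
      ((hasDerivAt_id' Tr).add_const Er).const_mul CB
    have hprod := hlin.fun_mul (hexp.const_sub 1)
    refine (hprod.congr_of_eventuallyEq ?_).congr_deriv (by ring)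
    filter_upwards [Iio_mem_nhds hTr] with z hz
    exact if_pos hz
  · have hexp : Real.exp (-(CB * (Ts - x)) / (θb * (Pd - PA))) <
        Real.exp (-(CB * (Ts - y)) / (θb * (Pd - PA))) := by
      gcongr
    have hpos : 0 < CB * (x + Er) / (θb * (Pd - PA)) :=
      div_pos (mul_pos hCB (by linarith [hx.1])) hk
    have hlin : CB * (x + Er) / (θb * (Pd - PA)) < CB * (y + Er) / (θb * (Pd - PA)) := by
      gcongr
    refine mul_lt_mul_of_pos_left (sub_lt_sub_left ?_ 1) hCB
    exact mul_lt_mul hexp (by linarith) (by linarith) (Real.exp_pos _).le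
end

section
/- Suppose T_s > 0. Then the function T_r ↦ R_r(T_r, T_s) is differentiable at every T_r with 0 < T_r < (P_A/P_d)·T_s, with derivative D(T_r) = C_B·(exp(−C_B·T_r/(θ̄·P_A))·(1 − C_B·(T_r + E_r)/(θ̄·P_A)) − exp(−C_B·(T_s − T_r)/(θ̄·(P_d − P_A)))·(1 + C_B·(T_r + E_r)/(θ̄·(P_d − P_A)))); moreover D is strictly decreasing on the interval (max{0, −E_r}, min{θ̄·P_A/C_B − E_r, (P_A/P_d)·T_s}). -/
/-- For `Ts > 0`, the revenue `Tr ↦ Rr Tr Ts` is differentiable at every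
`0 < Tr < (PA/Pd)·Ts` with derivative
`D(Tr) = CB·(exp(−CB·Tr/(θ̄·PA))·(1 − CB(Tr+Er)/(θ̄·PA))
        − exp(−CB(Ts−Tr)/(θ̄(Pd−PA)))·(1 + CB(Tr+Er)/(θ̄(Pd−PA))))`;
moreover `D` is strictly decreasing on
`(max{0, −Er}, min{θ̄·PA/CB − Er, (PA/Pd)·Ts})`. -/
theorem stmt11 (t θb CB PA Pd Er Ts : ℝ) (ht : 0 < t) (hθ : 0 < θb) (hCB : 0 < CB)
    (hPA : 0 < PA) (hPd : PA < Pd) (hTs : 0 < Ts) :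
    (∀ Tr : ℝ, 0 < Tr → Tr < (PA / Pd) * Ts →
      HasDerivAt (fun x => Rr θb CB PA Pd Er Ts x)
        (CB * (Real.exp (-(CB * Tr) / (θb * PA)) * (1 - CB * (Tr + Er) / (θb * PA)) -
          Real.exp (-(CB * (Ts - Tr)) / (θb * (Pd - PA))) *
            (1 + CB * (Tr + Er) / (θb * (Pd - PA))))) Tr) ∧
    StrictAntiOn
      (fun Tr => CB * (Real.exp (-(CB * Tr) / (θb * PA)) * (1 - CB * (Tr + Er) / (θb * PA)) -
        Real.exp (-(CB * (Ts - Tr)) / (θb * (Pd - PA))) *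
          (1 + CB * (Tr + Er) / (θb * (Pd - PA)))))
      (Set.Ioo (max 0 (-Er)) (min (θb * PA / CB - Er) ((PA / Pd) * Ts))) := by
  have hPdA : 0 < Pd - PA := sub_pos.mpr hPd
  have ha : 0 < θb * PA := mul_pos hθ hPA
  have hb : 0 < θb * (Pd - PA) := mul_pos hθ hPdA
  constructor
  · intro Tr h0 h1
    have hsum : HasDerivAt (fun x : ℝ => CB * (x + Er)) CB Tr := by
      simpa using ((hasDerivAt_id Tr).add_const Er).const_mul CB
    have hexpA : HasDerivAt (fun x : ℝ => Real.exp (-(CB * x) / (θb * PA)))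
        (Real.exp (-(CB * Tr) / (θb * PA)) * (-(CB * 1) / (θb * PA))) Tr :=
      ((((hasDerivAt_id Tr).const_mul CB).neg).div_const (θb * PA)).exp
    have hexpB : HasDerivAt (fun x : ℝ => Real.exp (-(CB * (Ts - x)) / (θb * (Pd - PA))))
        (Real.exp (-(CB * (Ts - Tr)) / (θb * (Pd - PA))) *
          (-(CB * (-1)) / (θb * (Pd - PA)))) Tr :=
      (((((hasDerivAt_id Tr).const_sub Ts).const_mul CB).neg).div_const (θb * (Pd - PA))).exp
    have hprod := (hsum.mul (hexpA.sub hexpB)).congr_of_eventuallyEq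
      (f₁ := fun x => Rr θb CB PA Pd Er Ts x) (by
        filter_upwards [Ioo_mem_nhds h0 h1] with x hx
        simp [Rr, not_lt.mpr hx.1.le, hx.2.le])
    refine hprod.congr_deriv ?_
    simp only [Pi.sub_apply]
    ring
  · intro x hx y hy hxy
    simp only [Set.mem_Ioo, max_lt_iff, lt_min_iff] at hx hy
    have hy1 : CB * (y + Er) / (θb * PA) < 1 := by
      rw [div_lt_one ha, mul_comm, ← lt_div_iff₀ hCB]
      linarith [hy.2.1]
    have hx0 : 0 < CB * (x + Er) / (θb * (Pd - PA)) :=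
      div_pos (mul_pos hCB (by linarith [hx.1.2])) hb
    have hdecr : Real.exp (-(CB * y) / (θb * PA)) * (1 - CB * (y + Er) / (θb * PA)) <
        Real.exp (-(CB * x) / (θb * PA)) * (1 - CB * (x + Er) / (θb * PA)) := by
      apply mul_lt_mul'' _ _ (Real.exp_pos _).le (by linarith)
      · gcongr
      · gcongr
    have hincr : Real.exp (-(CB * (Ts - x)) / (θb * (Pd - PA))) *
          (1 + CB * (x + Er) / (θb * (Pd - PA))) <
        Real.exp (-(CB * (Ts - y)) / (θb * (Pd - PA))) *
          (1 + CB * (y + Er) / (θb * (Pd - PA))) := by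
      apply mul_lt_mul'' _ _ (Real.exp_pos _).le (by linarith)
      · gcongr
      · gcongr
    exact mul_lt_mul_of_pos_left (by linarith) hCB
end

section
/- Suppose T_s > 0. Then the function T_r ↦ R_r(T_r, T_s) has a left derivative d⁻ and a right derivative d⁺ at T_r = 0, and d⁻ − d⁺ = C_B²·E_r/(θ̄·P_A). In particular, if E_r > 0 then the left derivative at 0 strictly exceeds the right derivative at 0 (the marginal revenue of the regulation station jumps downward at the price T_r = 0). -/
/-- Derivative at `0` of a revenue branch whose upper survival term is `F`. -/
theorem hasDerivAt_revenue_branch {F : ℝ → ℝ} {F' : ℝ} (CB Er Ts D : ℝ)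
    (hF : HasDerivAt F F' 0) :
    HasDerivAt (fun x => CB * (x + Er) * (F x - Real.exp (-(CB * (Ts - x)) / D)))
      (CB * (F 0 - Real.exp (-(CB * Ts) / D)) +
        CB * Er * (F' - Real.exp (-(CB * Ts) / D) * (CB / D))) 0 := by
  have hlin : HasDerivAt (fun x : ℝ => CB * (x + Er)) (CB * 1) 0 :=
    ((hasDerivAt_id (0 : ℝ)).add_const Er).const_mul CB
  have hexp : HasDerivAt (fun x : ℝ => Real.exp (-(CB * (Ts - x)) / D))
      (Real.exp (-(CB * (Ts - 0)) / D) * (-(CB * (-1)) / D)) 0 :=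
    (((((hasDerivAt_id (0 : ℝ)).const_sub Ts).const_mul CB).neg).div_const D).exp
  refine (hlin.mul (hF.sub hexp)).congr_deriv ?_
  simp

/-- For `Ts > 0`, `Tr ↦ Rr Tr Ts` has a left derivative `d⁻` and a right derivative `d⁺`
at `Tr = 0`, with `d⁻ − d⁺ = CB²·Er/(θ̄·PA)`; in particular if `Er > 0` the marginal
revenue jumps downward at `Tr = 0`. -/
theorem stmt12 (t θb CB PA Pd Er Ts : ℝ) (ht : 0 < t) (hθ : 0 < θb) (hCB : 0 < CB)
    (hPA : 0 < PA) (hPd : PA < Pd) (hTs : 0 < Ts) :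
    ∃ dm dp : ℝ,
      HasDerivWithinAt (fun Tr => Rr θb CB PA Pd Er Ts Tr) dm (Set.Iic 0) 0 ∧
      HasDerivWithinAt (fun Tr => Rr θb CB PA Pd Er Ts Tr) dp (Set.Ici 0) 0 ∧
      dm - dp = CB ^ 2 * Er / (θb * PA) ∧
      (0 < Er → dp < dm) := by
  have hbound : 0 < PA / Pd * Ts := mul_pos (div_pos hPA (hPA.trans hPd)) hTs
  have hF : HasDerivAt (fun x : ℝ => Real.exp (-(CB * x) / (θb * PA)))
      (Real.exp (-(CB * 0) / (θb * PA)) * (-(CB * 1) / (θb * PA))) 0 :=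
    ((((hasDerivAt_id (0 : ℝ)).const_mul CB).neg).div_const (θb * PA)).exp
  have hleft := hasDerivAt_revenue_branch CB Er Ts (θb * (Pd - PA))
    (hasDerivAt_const (0 : ℝ) (1 : ℝ))
  have hright := hasDerivAt_revenue_branch CB Er Ts (θb * (Pd - PA)) hF
  have hjump : ∀ a e : ℝ, CB * (1 - e) + CB * Er * (0 - a) -
      (CB * (Real.exp (-(CB * 0) / (θb * PA)) - e) +
        CB * Er * (Real.exp (-(CB * 0) / (θb * PA)) * (-(CB * 1) / (θb * PA)) - a)) =
      CB ^ 2 * Er / (θb * PA) := by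
    intro a e
    simp only [mul_zero, neg_zero, zero_div, Real.exp_zero]
    ring
  refine ⟨_, _, hleft.hasDerivWithinAt.congr_of_mem ?_ Set.self_mem_Iic,
    hright.hasDerivWithinAt.congr_of_eventuallyEq_of_mem ?_ Set.self_mem_Ici,
    hjump _ _, fun hEr => ?_⟩
  · intro x hx
    rcases lt_or_eq_of_le (Set.mem_Iic.mp hx) with h | rfl
    · simp [Rr, h]
    · simp [Rr, hbound.le]
  · filter_upwards [self_mem_nhdsWithin, mem_nhdsWithin_of_mem_nhds (Iic_mem_nhds hbound)]
      with x hx hxb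
    simp only [Rr, if_neg (not_lt.mpr (Set.mem_Ici.mp hx)), if_pos (Set.mem_Iic.mp hxb)]
  · rw [← sub_pos, hjump _ _]
    positivity
end

section
/- Suppose −(P_A/P_d)·(t + P_d·θ̄/C_B) ≤ E_r ≤ −(P_A/P_d)·(t + (P_d − P_A)·θ̄/C_B). Then the price profile (T_s, T_r) = ((P_d/P_A)·(−E_r), −E_r) is a Nash equilibrium of the pricing game: T_s = (P_d/P_A)·(−E_r) maximizes R_s(·, T_r) over ℝ, and T_r = −E_r maximizes R_r(·, T_s) over ℝ (equilibrium case (7a) of Theorem 3). -/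
/-- First-order optimality test for `x ↦ x * exp (-(c * x))`, whose maximum is at `1 / c`. -/
theorem mul_exp_le_mul_exp_of_mul_nonneg {c x y a b : ℝ} (hy : 0 ≤ y)
    (h : 0 ≤ (x - y) * (c * y - 1)) (hab : b - a = c * (x - y)) :
    x * Real.exp a ≤ y * Real.exp b := by
  have hexp : 1 + c * (x - y) ≤ Real.exp (b - a) := by
    rw [hab]
    linarith [Real.add_one_le_exp (c * (x - y))]
  have hx : x ≤ y * Real.exp (b - a) := by
    have := mul_le_mul_of_nonneg_left hexp hy
    linarith
  calc x * Real.exp a ≤ y * Real.exp (b - a) * Real.exp a := by gcongr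
    _ = y * Real.exp b := by rw [mul_assoc, ← Real.exp_add, sub_add_cancel]

/-- Equilibrium case (7a) of Theorem 3: if
`−(PA/Pd)·(t + Pd·θ̄/CB) ≤ Er ≤ −(PA/Pd)·(t + (Pd − PA)·θ̄/CB)`, then
`(Ts, Tr) = ((Pd/PA)·(−Er), −Er)` is a Nash equilibrium of the pricing game. -/
theorem stmt13 (t θb CB PA Pd Er : ℝ) (ht : 0 < t) (hθ : 0 < θb) (hCB : 0 < CB)
    (hPA : 0 < PA) (hPd : PA < Pd)
    (h1 : -(PA / Pd) * (t + Pd * θb / CB) ≤ Er)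
    (h2 : Er ≤ -(PA / Pd) * (t + (Pd - PA) * θb / CB)) :
    (∀ Ts : ℝ, Rs t θb CB PA Pd Ts (-Er) ≤
      Rs t θb CB PA Pd ((Pd / PA) * (-Er)) (-Er)) ∧
    (∀ Tr : ℝ, Rr θb CB PA Pd Er ((Pd / PA) * (-Er)) Tr ≤
      Rr θb CB PA Pd Er ((Pd / PA) * (-Er)) (-Er)) := by
  have hPd0 : 0 < Pd := hPA.trans hPd
  have hD : 0 < Pd - PA := sub_pos.2 hPd
  obtain ⟨s, hs⟩ : ∃ s, s = (Pd / PA) * (-Er) := ⟨_, rfl⟩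
  have hEr : Er = -(PA / Pd) * s := by rw [hs]; field_simp
  have hratio : 0 < PA / Pd := div_pos hPA hPd0
  have hs_le : s ≤ t + Pd * θb / CB := by
    rw [hEr] at h1
    exact le_of_mul_le_mul_left (by linarith) hratio
  have hs_ge : t + (Pd - PA) * θb / CB ≤ s := by
    rw [hEr] at h2
    exact le_of_mul_le_mul_left (by linarith) hratio
  have hmargin : 0 < s - t := by
    have : 0 < (Pd - PA) * θb / CB := by positivity
    linarith
  have hs0 : 0 < s := by linarith
  have hEr0 : Er < 0 := by
    rw [hEr]
    nlinarith [mul_pos hratio hs0]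
  rw [← hs]
  refine ⟨fun T => ?_, fun T => ?_⟩
  · rw [Rs, Rs, ← hs, if_pos le_rfl]
    split_ifs with hT
    · rw [mul_assoc, mul_assoc]
      refine mul_le_mul_of_nonneg_left ?_ hCB.le
      refine mul_exp_le_mul_exp_of_mul_nonneg (c := CB / (θb * Pd)) hmargin.le ?_ ?_
      · have : CB / (θb * Pd) * (s - t) ≤ 1 := by
          rw [div_mul_eq_mul_div, div_le_one (by positivity)]
          have := (le_div_iff₀ hCB).1 (sub_le_iff_le_add'.2 hs_le)
          linarith
        exact mul_nonneg_of_nonpos_of_nonpos (by linarith) (by linarith)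
      · field_simp
        ring
    · rw [mul_assoc, mul_assoc]
      refine mul_le_mul_of_nonneg_left ?_ hCB.le
      refine mul_exp_le_mul_exp_of_mul_nonneg (c := CB / (θb * (Pd - PA))) hmargin.le ?_ ?_
      · have : 1 ≤ CB / (θb * (Pd - PA)) * (s - t) := by
          rw [div_mul_eq_mul_div, one_le_div (by positivity)]
          have := (div_le_iff₀ hCB).1 (le_sub_iff_add_le'.2 hs_ge)
          linarith
        exact mul_nonneg (by linarith) (by linarith)
      · rw [hEr]
        field_simp
        ring
  · have hvalue : Rr θb CB PA Pd Er s (-Er) = 0 := by simp [Rr]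
    rw [hvalue, Rr]
    split_ifs with hneg hT
    · refine mul_nonpos_of_nonpos_of_nonneg
        (mul_nonpos_of_nonneg_of_nonpos hCB.le (by linarith)) ?_
      rw [sub_nonneg, Real.exp_le_one_iff, neg_div, neg_nonpos]
      have : 0 < s - T := by linarith
      positivity
    · refine mul_nonpos_of_nonpos_of_nonneg
        (mul_nonpos_of_nonneg_of_nonpos hCB.le (by linarith)) ?_
      rw [sub_nonneg, Real.exp_le_exp, neg_div, neg_div, neg_le_neg_iff,
        div_le_div_iff₀ (by positivity) (by positivity)]
      have hT' : T * Pd ≤ PA * s := by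
        rwa [div_mul_eq_mul_div, le_div_iff₀ hPd0] at hT
      have := mul_le_mul_of_nonneg_left hT' (mul_pos hCB hθ).le
      linarith
    · exact le_rfl
end

section
/- Let T_s* = t + (P_d − P_A)·θ̄/C_B and suppose −(P_A/P_d)·T_s* < E_r < E_{r,1}(T_s*). Then there exists T_r* in the open interval (0, min{θ̄·P_A/C_B − E_r, (P_A/P_d)·T_s*}) such that (T_s*, T_r*) is a Nash equilibrium of the pricing game: T_s* maximizes R_s(·, T_r*) over ℝ and T_r* maximizes R_r(·, T_s*) over ℝ (equilibrium case (7b) of Theorem 3). -/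
/-- The threshold `E_{r,1}(Ts)`. -/
noncomputable def Er1 (θb CB PA Pd Ts : ℝ) : ℝ :=
  θb * (Pd - PA) * (1 - Real.exp (-(CB * Ts) / (θb * (Pd - PA)))) /
    (CB * (Pd / PA - 1 + Real.exp (CB * Ts / (θb * (Pd - PA)))))

/-- The function `(x - t) * exp (-(b * (x - r)))` is maximal at `x = t + 1 / b`. -/
lemma mul_exp_neg_mul_sub_le {b t r x : ℝ} (hb : 0 < b) :
    (x - t) * Real.exp (-(b * (x - r))) ≤
      (t + 1 / b - t) * Real.exp (-(b * (t + 1 / b - r))) := by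
  have h := Real.add_one_le_exp (b * (x - t) - 1)
  have h3 : Real.exp (-(b * (t + 1 / b - r))) =
      Real.exp (b * (x - t) - 1) * Real.exp (-(b * (x - r))) := by
    rw [← Real.exp_add]
    congr 1
    field_simp
    ring
  rw [h3, ← mul_assoc]
  refine mul_le_mul_of_nonneg_right ?_ (Real.exp_pos _).le
  rw [add_sub_cancel_left, one_div, inv_mul_eq_div, le_div_iff₀ hb]
  linarith

/-- On negative prices the regulation revenue stays below its value at price zero. -/
lemma regulation_neg_branch_le {b S E r : ℝ} (hb : 0 < b) (hr : r < 0) (hrE : 0 ≤ r + E)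
    (hE : E * (b * Real.exp (-(b * S))) ≤ 1 - Real.exp (-(b * S))) :
    (r + E) * (1 - Real.exp (-(b * (S - r)))) ≤ E * (1 - Real.exp (-(b * S))) := by
  have h1 : Real.exp (-(b * (S - r))) = Real.exp (-(b * S)) * Real.exp (b * r) := by
    rw [← Real.exp_add]
    congr 1
    ring
  have hq := Real.exp_pos (-(b * S))
  rw [h1]
  set q := Real.exp (-(b * S))
  have h2 : q * (b * r + 1) ≤ q * Real.exp (b * r) :=
    mul_le_mul_of_nonneg_left (Real.add_one_le_exp _) hq.le
  have h3 : (r + E) * (1 - q * Real.exp (b * r)) ≤ (r + E) * (1 - q * (b * r + 1)) :=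
    mul_le_mul_of_nonneg_left (by linarith) hrE
  have h4 : 0 ≤ (1 - q - E * (b * q)) * (-r) := mul_nonneg (by linarith) (by linarith)
  have h5 : 0 ≤ q * b * r ^ 2 := by positivity
  nlinarith

/-- The regulation revenue on moderate prices has an interior maximizer. -/
lemma exists_regulation_maximizer {a b k S E : ℝ} (ha : 0 < a) (hb : 0 < b) (hk : 0 < k)
    (hS : 0 < S) (hak : a * k = b * (1 - k)) (hE1 : -(k * S) < E)
    (hE2 : E * (a + b * Real.exp (-(b * S))) < 1 - Real.exp (-(b * S))) :
    ∃ r, 0 < r ∧ r < 1 / a - E ∧ r < k * S ∧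
      0 < (r + E) * (Real.exp (-(a * r)) - Real.exp (-(b * (S - r)))) ∧
      ∀ x ∈ Set.Icc 0 (k * S), (x + E) * (Real.exp (-(a * x)) - Real.exp (-(b * (S - x)))) ≤
        (r + E) * (Real.exp (-(a * r)) - Real.exp (-(b * (S - r)))) := by
  have hkS : 0 < k * S := mul_pos hk hS
  obtain ⟨F, hF⟩ : ∃ F : ℝ → ℝ, F = fun x =>
      (x + E) * (Real.exp (-(a * x)) - Real.exp (-(b * (S - x)))) := ⟨_, rfl⟩
  have hFx : ∀ x, F x = (x + E) * (Real.exp (-(a * x)) - Real.exp (-(b * (S - x)))) :=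
    fun x => by rw [hF]
  have hd : ∀ x, HasDerivAt F ((Real.exp (-(a * x)) - Real.exp (-(b * (S - x)))) -
      (x + E) * (a * Real.exp (-(a * x)) + b * Real.exp (-(b * (S - x))))) x := by
    intro x
    have e1 : HasDerivAt (fun x : ℝ => Real.exp (-(a * x))) _ x :=
      (((hasDerivAt_id x).const_mul a).neg).exp
    have e2 : HasDerivAt (fun x : ℝ => Real.exp (-(b * (S - x)))) _ x :=
      ((((hasDerivAt_id x).const_sub S).const_mul b).neg).exp
    have e3 := ((hasDerivAt_id x).add_const E).mul (e1.sub e2)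
    rw [hF]
    refine e3.congr_deriv ?_
    simp only [Pi.sub_apply, Pi.neg_apply, id]
    ring
  have hcont : Continuous F := continuous_iff_continuousAt.2 fun x => (hd x).continuousAt
  obtain ⟨r, hr, hmax⟩ := isCompact_Icc.exists_isMaxOn (Set.nonempty_Icc.2 hkS.le)
    hcont.continuousOn
  have hmax' : ∀ x ∈ Set.Icc 0 (k * S), F x ≤ F r := fun x hx => hmax hx
  have hpos : 0 < F r := by
    obtain ⟨y, hy1, hy2⟩ := exists_between (max_lt hkS (by linarith : -E < k * S))
    have hy0 := (le_max_left _ _).trans_lt hy1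
    have hyE := (le_max_right _ _).trans_lt hy1
    refine lt_of_lt_of_le ?_ (hmax' y ⟨hy0.le, hy2.le⟩)
    rw [hFx]
    refine mul_pos (by linarith) (sub_pos.2 (Real.exp_lt_exp.2 (neg_lt_neg ?_)))
    have h1 : a * y < a * (k * S) := mul_lt_mul_of_pos_left hy2 ha
    have h2 : b * (S - k * S) < b * (S - y) := mul_lt_mul_of_pos_left (by linarith) hb
    have h3 : a * (k * S) = b * (S - k * S) := by linear_combination S * hak
    linarith
  have hrk : r < k * S := by
    refine lt_of_le_of_ne hr.2 fun h => ?_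
    have h3 : a * (k * S) = b * (S - k * S) := by linear_combination S * hak
    rw [hFx, h, h3, sub_self, mul_zero] at hpos
    exact lt_irrefl _ hpos
  have hr0 : 0 < r := by
    refine lt_of_le_of_ne hr.1 fun h => ?_
    have hd0 := hd 0
    simp only [mul_zero, neg_zero, Real.exp_zero, sub_zero, zero_add, mul_one] at hd0
    have ht := (hasDerivAt_iff_tendsto_slope.1 hd0).mono_left
      (nhdsWithin_mono 0 (fun x (hx : 0 < x) => hx.ne') : nhdsWithin (0 : ℝ) (Set.Ioi 0) ≤ _)
    have hev := ht.eventually (lt_mem_nhds (sub_pos.2 hE2))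
    obtain ⟨x, hx, hx0, hxk⟩ := (hev.and (Ioo_mem_nhdsGT hkS)).exists
    rw [slope_def_field, sub_zero] at hx
    have h1 := hmax' x ⟨hx0.le, hxk.le⟩
    rw [← h] at h1
    exact absurd hx (not_lt.2 (div_nonpos_of_nonpos_of_nonneg (by linarith) hx0.le))
  have hcrit := (hmax.isLocalMax (Icc_mem_nhds hr0 hrk)).hasDerivAt_eq_zero (hd r)
  refine ⟨r, hr0, ?_, hrk, by rwa [← hFx], fun x hx => by rw [← hFx, ← hFx]; exact hmax' x hx⟩
  have hA := Real.exp_pos (-(a * r))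
  have hB := Real.exp_pos (-(b * (S - r)))
  rw [hFx] at hpos
  rw [lt_sub_iff_add_lt, lt_div_iff₀ ha]
  by_contra! hc
  have hrE : 0 < r + E := by
    by_contra! h
    nlinarith
  have h1 := mul_le_mul_of_nonneg_right hc hA.le
  have h2 : 0 < (r + E) * (b * Real.exp (-(b * (S - r)))) := by positivity
  nlinarith

/-- Equilibrium case (7b) of Theorem 3: let `Ts* = t + (Pd − PA)·θ̄/CB` and suppose
`−(PA/Pd)·Ts* < Er < E_{r,1}(Ts*)`. Then there is `Tr*` in
`(0, min{θ̄·PA/CB − Er, (PA/Pd)·Ts*})` such that `(Ts*, Tr*)` is a Nash equilibrium. -/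
theorem stmt15 (t θb CB PA Pd Er : ℝ) (ht : 0 < t) (hθ : 0 < θb) (hCB : 0 < CB)
    (hPA : 0 < PA) (hPd : PA < Pd)
    (h1 : -(PA / Pd) * (t + (Pd - PA) * θb / CB) < Er)
    (h2 : Er < Er1 θb CB PA Pd (t + (Pd - PA) * θb / CB)) :
    ∃ Trs : ℝ,
      Trs ∈ Set.Ioo 0
        (min (θb * PA / CB - Er) ((PA / Pd) * (t + (Pd - PA) * θb / CB))) ∧
      (∀ Ts : ℝ, Rs t θb CB PA Pd Ts Trs ≤
        Rs t θb CB PA Pd (t + (Pd - PA) * θb / CB) Trs) ∧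
      (∀ Tr : ℝ, Rr θb CB PA Pd Er (t + (Pd - PA) * θb / CB) Tr ≤
        Rr θb CB PA Pd Er (t + (Pd - PA) * θb / CB) Trs) := by
  have hD : 0 < Pd - PA := sub_pos.2 hPd
  have hPd0 : 0 < Pd := hPA.trans hPd
  obtain ⟨a, ha⟩ : ∃ a, a = CB / (θb * PA) := ⟨_, rfl⟩
  obtain ⟨b, hb⟩ : ∃ b, b = CB / (θb * (Pd - PA)) := ⟨_, rfl⟩
  obtain ⟨k, hk⟩ : ∃ k, k = PA / Pd := ⟨_, rfl⟩
  have ha0 : 0 < a := by rw [ha]; positivity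
  have hb0 : 0 < b := by rw [hb]; positivity
  have hk0 : 0 < k := by rw [hk]; positivity
  have hak : a * k = b * (1 - k) := by
    rw [ha, hb, hk]
    field_simp
  have hinv : (Pd - PA) * θb / CB = 1 / b := by
    rw [hb]
    field_simp
  have hainv : θb * PA / CB = 1 / a := by
    rw [ha]
    field_simp
  have hka : Pd / PA = 1 / k := by
    rw [hk]
    field_simp
  have hea : ∀ x, -(CB * x) / (θb * PA) = -(a * x) := fun x => by rw [ha]; ring
  have heb : ∀ x, -(CB * x) / (θb * (Pd - PA)) = -(b * x) := fun x => by rw [hb]; ring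
  have hec : ∀ x, -(CB * x) / (θb * Pd) = -(a * k * x) := fun x => by
    rw [ha, hk]
    field_simp
  rw [hinv] at h1 h2
  rw [hinv, hainv]
  obtain ⟨S, hS⟩ : ∃ S, S = t + 1 / b := ⟨_, rfl⟩
  have hS0 : 0 < S := by rw [hS]; positivity
  have hq1 : Real.exp (-(b * S)) < 1 := Real.exp_lt_one_iff.2 (neg_lt_zero.2 (mul_pos hb0 hS0))
  have hE : Er * (a + b * Real.exp (-(b * S))) < 1 - Real.exp (-(b * S)) := by
    rw [← hS, Er1, lt_div_iff₀, heb] at h2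
    · have hq2 : Real.exp (-(b * S)) ≤ Real.exp (CB * S / (θb * (Pd - PA))) := by
        rw [mul_div_right_comm, ← hb]
        exact Real.exp_le_exp.2 (by linarith [mul_pos hb0 hS0])
      have h3 : Er * (a + b * Real.exp (CB * S / (θb * (Pd - PA)))) <
          1 - Real.exp (-(b * S)) := by
        have e1 : Er * (a + b * Real.exp (CB * S / (θb * (Pd - PA)))) =
            Er * (CB * (Pd / PA - 1 + Real.exp (CB * S / (θb * (Pd - PA))))) /
              (θb * (Pd - PA)) := by
          rw [ha, hb]
          field_simp
        rw [e1, div_lt_iff₀ (mul_pos hθ hD)]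
        linarith
      rcases le_or_gt Er 0 with h | h
      · have : 0 ≤ a + b * Real.exp (-(b * S)) := by positivity
        nlinarith [mul_nonneg (neg_nonneg.2 h) this]
      · have := mul_le_mul_of_nonneg_left hq2 (mul_pos h hb0).le
        nlinarith
    · have : 0 < Pd / PA - 1 := sub_pos.2 ((one_lt_div hPA).2 hPd)
      positivity
  rw [← hk, ← hS] at h1
  obtain ⟨r, hr0, hra, hrk, hpos, hmax⟩ :=
    exists_regulation_maximizer ha0 hb0 hk0 hS0 hak (by linarith) hE
  refine ⟨r, ⟨hr0, lt_min hra (by rwa [← hk, ← hS])⟩, fun Ts => ?_, fun Tr => ?_⟩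
  · have hSk : ¬ (t + 1 / b ≤ 1 / k * r) := by
      rw [← hS, not_le, one_div, inv_mul_eq_div, div_lt_iff₀ hk0]
      linarith
    have key := mul_exp_neg_mul_sub_le (t := t) (r := r) (x := Ts) hb0
    have hR : 0 ≤ (t + 1 / b - t) * Real.exp (-(b * (t + 1 / b - r))) := by
      rw [add_sub_cancel_left]
      positivity
    simp only [Rs, hka, heb, hec, if_neg hSk]
    rw [mul_assoc CB (t + 1 / b - t)]
    split_ifs with h
    · rw [mul_assoc]
      refine mul_le_mul_of_nonneg_left ?_ hCB.le
      rcases le_or_gt Ts t with hT | hT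
      · exact (mul_nonpos_of_nonpos_of_nonneg (by linarith) (Real.exp_pos _).le).trans hR
      · refine (mul_le_mul_of_nonneg_left (Real.exp_le_exp.2 ?_) (by linarith)).trans key
        rw [one_div, inv_mul_eq_div, le_div_iff₀ hk0] at h
        rw [hak]
        nlinarith
    · rw [mul_assoc]
      exact mul_le_mul_of_nonneg_left key hCB.le
  · rw [← hS]
    simp only [Rr, hea, heb, ← hk, if_neg hr0.not_gt, if_pos hrk.le]
    rw [mul_assoc CB (r + Er)]
    split_ifs with h h'
    · rw [mul_assoc]
      refine mul_le_mul_of_nonneg_left ?_ hCB.le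
      rcases le_or_gt (Tr + Er) 0 with hT | hT
      · refine (mul_nonpos_of_nonpos_of_nonneg hT (sub_nonneg.2 (Real.exp_le_one_iff.2 ?_))).trans
          hpos.le
        nlinarith
      · have h0 := hmax 0 ⟨le_rfl, (mul_pos hk0 hS0).le⟩
        simp only [mul_zero, neg_zero, Real.exp_zero, sub_zero, zero_add] at h0
        refine (regulation_neg_branch_le hb0 h hT.le ?_).trans h0
        nlinarith [mul_pos (by linarith : 0 < Er) ha0]
    · rw [mul_assoc]
      exact mul_le_mul_of_nonneg_left (hmax Tr ⟨not_lt.1 h, h'⟩) hCB.le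
    · exact (mul_pos hCB hpos).le
end

section
/- Suppose E_r ≤ −(P_A/P_d)·(t + (P_d − P_A)·θ̄/C_B) and −E_r·(P_d/P_A) ≤ t + θ̄·P_d/C_B. Then for all T_s′, T_s″ with 0 ≤ T_s′ < T_s″ ≤ −E_r·(P_d/P_A): R_r((P_A/P_d)·T_s′, T_s′) = R_r((P_A/P_d)·T_s″, T_s″) = 0 and R_s(T_s′, (P_A/P_d)·T_s′) < R_s(T_s″, (P_A/P_d)·T_s″). Hence, among all price profiles of the form (T_s, (P_A/P_d)·T_s) with 0 ≤ T_s ≤ −E_r·(P_d/P_A), the profile with T_s = −E_r·(P_d/P_A) Pareto-dominates every other one. -/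
/-- The function `x ↦ (x - t) * exp (-(a * x))` is strictly increasing up to its maximiser. -/
theorem strictMonoOn_sub_mul_exp_neg_mul {a : ℝ} (ha : 0 < a) (t : ℝ) :
    StrictMonoOn (fun x ↦ (x - t) * Real.exp (-(a * x))) (Set.Iic (t + 1 / a)) := by
  intro x _ y hy hxy
  have hay : a * (y - t) ≤ 1 := by
    rw [mul_comm, ← le_div_iff₀ ha]
    linarith [Set.mem_Iic.mp hy]
  have hd : 0 < a * (y - x) := mul_pos ha (sub_pos.mpr hxy)
  have key : x - t < (y - t) * Real.exp (-(a * (y - x))) := by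
    rcases le_or_gt y t with hyt | hyt
    · have : Real.exp (-(a * (y - x))) ≤ 1 := Real.exp_le_one_iff.mpr (by linarith)
      nlinarith
    · have := Real.add_one_lt_exp (neg_ne_zero.mpr hd.ne')
      nlinarith
  calc (x - t) * Real.exp (-(a * x))
      < (y - t) * Real.exp (-(a * (y - x))) * Real.exp (-(a * x)) := by gcongr
    _ = (y - t) * Real.exp (-(a * y)) := by
      rw [mul_assoc, ← Real.exp_add]
      ring_nf

theorem Rs_proportional {PA Pd : ℝ} (t θb CB T : ℝ) (hPA : PA ≠ 0) (hPd : Pd ≠ 0) :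
    Rs t θb CB PA Pd T ((PA / Pd) * T) =
      CB * ((T - t) * Real.exp (-(CB / (θb * Pd) * T))) := by
  have h : (Pd / PA) * ((PA / Pd) * T) = T := by field_simp
  rw [Rs, if_pos h.ge, mul_assoc]
  ring_nf

theorem Rr_proportional {θb PA Pd T : ℝ} (CB Er : ℝ) (hθ : θb ≠ 0) (hPA : 0 < PA)
    (hPd : PA < Pd) (hT : 0 ≤ T) : Rr θb CB PA Pd Er T ((PA / Pd) * T) = 0 := by
  have hPd0 : 0 < Pd := hPA.trans hPd
  have hsub : Pd - PA ≠ 0 := (sub_pos.mpr hPd).ne'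
  have h : -(CB * ((PA / Pd) * T)) / (θb * PA) =
      -(CB * (T - (PA / Pd) * T)) / (θb * (Pd - PA)) := by
    field_simp
  rw [Rr, if_neg (by positivity : 0 ≤ (PA / Pd) * T).not_gt, if_pos le_rfl, h, sub_self, mul_zero]

/-- Pareto dominance among the candidate equilibria `(Ts, (PA/Pd)·Ts)` with
`0 ≤ Ts ≤ −Er·(Pd/PA)`: the regulation station gets zero revenue on all of them, while
the fixed-power station's revenue is strictly increasing in `Ts`; hence the profile with
`Ts = −Er·(Pd/PA)` Pareto-dominates every other one. -/
theorem stmt17 (t θb CB PA Pd Er : ℝ) (ht : 0 < t) (hθ : 0 < θb) (hCB : 0 < CB)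
    (hPA : 0 < PA) (hPd : PA < Pd)
    (h1 : Er ≤ -(PA / Pd) * (t + (Pd - PA) * θb / CB))
    (h2 : -Er * (Pd / PA) ≤ t + θb * Pd / CB) :
    (∀ Ts' Ts'' : ℝ, 0 ≤ Ts' → Ts' < Ts'' → Ts'' ≤ -Er * (Pd / PA) →
      Rr θb CB PA Pd Er Ts' ((PA / Pd) * Ts') = 0 ∧
      Rr θb CB PA Pd Er Ts'' ((PA / Pd) * Ts'') = 0 ∧
      Rs t θb CB PA Pd Ts' ((PA / Pd) * Ts') <
        Rs t θb CB PA Pd Ts'' ((PA / Pd) * Ts'')) ∧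
    (∀ Ts' : ℝ, 0 ≤ Ts' → Ts' < -Er * (Pd / PA) →
      Rs t θb CB PA Pd Ts' ((PA / Pd) * Ts') <
        Rs t θb CB PA Pd (-Er * (Pd / PA)) ((PA / Pd) * (-Er * (Pd / PA))) ∧
      Rr θb CB PA Pd Er Ts' ((PA / Pd) * Ts') ≤
        Rr θb CB PA Pd Er (-Er * (Pd / PA)) ((PA / Pd) * (-Er * (Pd / PA)))) := by
  have hPd0 : 0 < Pd := hPA.trans hPd
  have hRr : ∀ T : ℝ, 0 ≤ T → Rr θb CB PA Pd Er T ((PA / Pd) * T) = 0 := fun T hT ↦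
    Rr_proportional CB Er hθ.ne' hPA hPd hT
  have hRs : ∀ x y : ℝ, x < y → y ≤ -Er * (Pd / PA) →
      Rs t θb CB PA Pd x ((PA / Pd) * x) < Rs t θb CB PA Pd y ((PA / Pd) * y) := by
    intro x y hxy hy
    rw [Rs_proportional _ _ _ _ hPA.ne' hPd0.ne', Rs_proportional _ _ _ _ hPA.ne' hPd0.ne']
    have hy' : y ≤ t + 1 / (CB / (θb * Pd)) := by
      rw [one_div_div]
      exact hy.trans h2
    exact mul_lt_mul_of_pos_left (strictMonoOn_sub_mul_exp_neg_mul (by positivity) t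
      (hxy.le.trans hy') hy' hxy) hCB
  refine ⟨fun x y hx hxy hy ↦ ⟨hRr x hx, hRr y (hx.trans hxy.le), hRs x y hxy hy⟩,
    fun x hx hxE ↦ ⟨hRs x _ hxE le_rfl, ?_⟩⟩
  rw [hRr x hx, hRr _ (hx.trans hxE.le)]
end

section
/- Suppose 0 ≤ T_r and T_r·P_d ≤ P_A·T_s. Then the user-welfare integral satisfies ∫_{T_r·C_B/P_A}^{(T_s − T_r)·C_B/(P_d − P_A)} (θ·P_A − T_r·C_B)·(1/θ̄)·exp(−θ/θ̄) dθ + ∫_{(T_s − T_r)·C_B/(P_d − P_A)}^{∞} (θ·P_d − T_s·C_B)·(1/θ̄)·exp(−θ/θ̄) dθ = α_r·θ̄·P_A + α_s·θ̄·P_d, where α_r = exp(−C_B·T_r/(θ̄·P_A)) − exp(−C_B·(T_s − T_r)/(θ̄·(P_d − P_A))) and α_s = exp(−C_B·(T_s − T_r)/(θ̄·(P_d − P_A))). -/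
open MeasureTheory

/-- An antiderivative of an affine function times the exponential density of mean `m`. -/
theorem hasDerivAt_affine_mul_exp_neg_div {m : ℝ} (hm : m ≠ 0) (P c x : ℝ) :
    HasDerivAt (fun y : ℝ => -((y * P - c + m * P) * Real.exp (-y / m)))
      ((x * P - c) * (1 / m) * Real.exp (-x / m)) x := by
  have h₁ : HasDerivAt (fun y : ℝ => y * P - c + m * P) (1 * P) x :=
    (((hasDerivAt_id x).mul_const P).sub_const c).add_const (m * P)
  have h₂ : HasDerivAt (fun y : ℝ => Real.exp (-y / m)) (Real.exp (-x / m) * (-1 / m)) x :=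
    ((hasDerivAt_id x).neg.div_const m).exp
  refine (h₁.mul h₂).neg.congr_deriv ?_
  field_simp
  ring

theorem tendsto_affine_mul_exp_neg_div {m : ℝ} (hm : 0 < m) (P c : ℝ) :
    Filter.Tendsto (fun y : ℝ => -((y * P - c + m * P) * Real.exp (-y / m)))
      Filter.atTop (nhds 0) := by
  have hdiv : Filter.Tendsto (fun y : ℝ => y / m) Filter.atTop Filter.atTop :=
    Filter.tendsto_id.atTop_div_const hm
  have h₀ := (Real.tendsto_pow_mul_exp_neg_atTop_nhds_zero 0).comp hdiv
  have h₁ := (Real.tendsto_pow_mul_exp_neg_atTop_nhds_zero 1).comp hdiv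
  convert (h₁.const_mul (-(m * P))).add (h₀.const_mul (c - m * P)) using 1
  · funext y
    simp only [Function.comp_apply, pow_zero, pow_one, one_mul, neg_div]
    field_simp
    ring
  · simp

theorem intervalIntegral_affine_mul_exp_neg_div {m : ℝ} (hm : m ≠ 0) (P c a b : ℝ) :
    ∫ x in a..b, (x * P - c) * (1 / m) * Real.exp (-x / m) =
      (a * P - c + m * P) * Real.exp (-a / m) - (b * P - c + m * P) * Real.exp (-b / m) := by
  rw [intervalIntegral.integral_eq_sub_of_hasDerivAt
    (fun x _ => hasDerivAt_affine_mul_exp_neg_div hm P c x)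
    (Continuous.intervalIntegrable (by fun_prop) a b)]
  ring

theorem integral_Ioi_affine_mul_exp_neg_div {m P c a : ℝ} (hm : 0 < m) (hP : 0 ≤ P)
    (ha : c ≤ a * P) :
    ∫ x in Set.Ioi a, (x * P - c) * (1 / m) * Real.exp (-x / m) =
      (a * P - c + m * P) * Real.exp (-a / m) := by
  rw [integral_Ioi_of_hasDerivAt_of_nonneg'
    (fun x _ => hasDerivAt_affine_mul_exp_neg_div hm.ne' P c x) (fun x hx => ?_)
    (tendsto_affine_mul_exp_neg_div hm P c)]
  · ring
  · have hxP : 0 ≤ x * P - c :=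
      sub_nonneg.2 (ha.trans (mul_le_mul_of_nonneg_right (le_of_lt hx) hP))
    positivity

/-- User-welfare identity: for `0 ≤ Tr` and `Tr·Pd ≤ PA·Ts`, the average user utility
(exponentially distributed willingness-to-pay `θ` with mean `θ̄`) equals
`α_r·θ̄·P_A + α_s·θ̄·P_d`, where
`α_r = exp(−CB·Tr/(θ̄·PA)) − exp(−CB·(Ts−Tr)/(θ̄·(Pd−PA)))` and
`α_s = exp(−CB·(Ts−Tr)/(θ̄·(Pd−PA)))`. -/
theorem stmt18 (t θb CB PA Pd Ts Tr : ℝ) (ht : 0 < t) (hθ : 0 < θb) (hCB : 0 < CB)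
    (hPA : 0 < PA) (hPd : PA < Pd) (hTr : 0 ≤ Tr) (hle : Tr * Pd ≤ PA * Ts) :
    (∫ x in (Tr * CB / PA)..((Ts - Tr) * CB / (Pd - PA)),
        (x * PA - Tr * CB) * (1 / θb) * Real.exp (-x / θb)) +
      (∫ x in Set.Ioi ((Ts - Tr) * CB / (Pd - PA)),
        (x * Pd - Ts * CB) * (1 / θb) * Real.exp (-x / θb)) =
    (Real.exp (-(CB * Tr) / (θb * PA)) -
        Real.exp (-(CB * (Ts - Tr)) / (θb * (Pd - PA)))) * θb * PA +
      Real.exp (-(CB * (Ts - Tr)) / (θb * (Pd - PA))) * θb * Pd := by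
  have hd : 0 < Pd - PA := sub_pos.2 hPd
  have hPd₀ : 0 < Pd := hPA.trans hPd
  have hthreshold : Ts * CB ≤ (Ts - Tr) * CB / (Pd - PA) * Pd := by
    rw [div_mul_eq_mul_div, le_div_iff₀ hd]
    nlinarith [mul_le_mul_of_nonneg_left hle hCB.le]
  rw [intervalIntegral_affine_mul_exp_neg_div hθ.ne',
    integral_Ioi_affine_mul_exp_neg_div hθ hPd₀.le hthreshold]
  have hexp₁ : -(Tr * CB / PA) / θb = -(CB * Tr) / (θb * PA) := by
    field_simp
  have hexp₂ : -((Ts - Tr) * CB / (Pd - PA)) / θb =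
      -(CB * (Ts - Tr)) / (θb * (Pd - PA)) := by
    field_simp
  have hlow : Tr * CB / PA * PA = Tr * CB := div_mul_cancel₀ _ hPA.ne'
  have hhigh : (Ts - Tr) * CB / (Pd - PA) * (Pd - PA) = (Ts - Tr) * CB :=
    div_mul_cancel₀ _ hd.ne'
  rw [hexp₁, hexp₂, hlow]
  linear_combination Real.exp (-(CB * (Ts - Tr)) / (θb * (Pd - PA))) * hhigh
end

section
/- Let Θ be a random variable with the exponential distribution of mean θ̄ (rate 1/θ̄), and suppose 0 ≤ T_r and T_r·P_d ≤ P_A·T_s. Then the probability that a user strictly prefers the regulation station, P(Θ·P_A − T_r·C_B ≥ 0 and Θ·P_A − T_r·C_B > Θ·P_d − T_s·C_B), equals exp(−C_B·T_r/(θ̄·P_A)) − exp(−C_B·(T_s − T_r)/(θ̄·(P_d − P_A))); and the probability that a user weakly prefers the fixed-power station, P(Θ·P_d − T_s·C_B ≥ 0 and Θ·P_d − T_s·C_B ≥ Θ·P_A − T_r·C_B), equals exp(−C_B·(T_s − T_r)/(θ̄·(P_d − P_A))). -/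
open MeasureTheory

/-- The survival function of the exponential distribution. -/
lemma expMeasure_Ici {r a : ℝ} (hr : 0 < r) (ha : 0 ≤ a) :
    ProbabilityTheory.expMeasure r (Set.Ici a) = ENNReal.ofReal (Real.exp (-(r * a))) := by
  have := ProbabilityTheory.isProbabilityMeasure_expMeasure hr
  have : NullSingletonClass (ProbabilityTheory.expMeasure r) := by
    unfold ProbabilityTheory.expMeasure ProbabilityTheory.gammaMeasure
    infer_instance
  have hcdf := ProbabilityTheory.cdf_expMeasure_eq hr a
  rw [if_pos ha, ProbabilityTheory.cdf_eq_real] at hcdf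
  rw [← measure_congr (Ioi_ae_eq_Ici (a := a)), ← Set.compl_Iic, ← ofReal_measureReal,
    probReal_compl_eq_one_sub measurableSet_Iic, hcdf, sub_sub_cancel]

/-- The mass that the exponential distribution gives to a bounded interval. -/
lemma expMeasure_Ico {r a b : ℝ} (hr : 0 < r) (ha : 0 ≤ a) (hab : a ≤ b) :
    ProbabilityTheory.expMeasure r (Set.Ico a b) =
      ENNReal.ofReal (Real.exp (-(r * a)) - Real.exp (-(r * b))) := by
  have := ProbabilityTheory.isProbabilityMeasure_expMeasure hr
  rw [← Set.Ici_sdiff_Ici, measure_sdiff (Set.Ici_subset_Ici.2 hab)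
    measurableSet_Ici.nullMeasurableSet (measure_ne_top _ _), expMeasure_Ici hr ha,
    expMeasure_Ici hr (ha.trans hab), ENNReal.ofReal_sub _ (Real.exp_nonneg _)]

/-- Market shares as probabilities: if `Θ` is exponentially distributed with mean `θ̄`
(rate `1/θ̄`), `0 ≤ Tr` and `Tr·Pd ≤ PA·Ts`, then the probability that a user strictly
prefers the regulation station is
`exp(−CB·Tr/(θ̄·PA)) − exp(−CB·(Ts−Tr)/(θ̄·(Pd−PA)))`, and the probability that a user
weakly prefers the fixed-power station is `exp(−CB·(Ts−Tr)/(θ̄·(Pd−PA)))`. -/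
theorem stmt19 {Ω : Type*} [MeasurableSpace Ω] (μ : Measure Ω) [IsProbabilityMeasure μ]
    (θb CB PA Pd Ts Tr : ℝ) (hθ : 0 < θb) (hCB : 0 < CB)
    (hPA : 0 < PA) (hPd : PA < Pd)
    (Θ : Ω → ℝ) (hΘ : Measurable Θ)
    (hlaw : μ.map Θ = ProbabilityTheory.expMeasure (1 / θb))
    (hTr : 0 ≤ Tr) (hle : Tr * Pd ≤ PA * Ts) :
    μ {ω | 0 ≤ Θ ω * PA - Tr * CB ∧ Θ ω * Pd - Ts * CB < Θ ω * PA - Tr * CB} =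
      ENNReal.ofReal (Real.exp (-(CB * Tr) / (θb * PA)) -
        Real.exp (-(CB * (Ts - Tr)) / (θb * (Pd - PA)))) ∧
    μ {ω | 0 ≤ Θ ω * Pd - Ts * CB ∧ Θ ω * PA - Tr * CB ≤ Θ ω * Pd - Ts * CB} =
      ENNReal.ofReal (Real.exp (-(CB * (Ts - Tr)) / (θb * (Pd - PA)))) := by
  have hD : 0 < Pd - PA := sub_pos.2 hPd
  have hr : 0 < 1 / θb := one_div_pos.2 hθ
  have ha : 0 ≤ Tr * CB / PA := by positivity
  have hab : Tr * CB / PA ≤ (Ts - Tr) * CB / (Pd - PA) := by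
    rw [div_le_div_iff₀ hPA hD]
    nlinarith
  have hcb : Ts * CB / Pd ≤ (Ts - Tr) * CB / (Pd - PA) := by
    rw [div_le_div_iff₀ (hPA.trans hPd) hD]
    nlinarith
  have hregulation : {ω | 0 ≤ Θ ω * PA - Tr * CB ∧ Θ ω * Pd - Ts * CB < Θ ω * PA - Tr * CB} =
      Θ ⁻¹' Set.Ico (Tr * CB / PA) ((Ts - Tr) * CB / (Pd - PA)) := by
    ext ω
    simp only [Set.mem_ofPred_eq, Set.mem_preimage, Set.mem_Ico, div_le_iff₀ hPA, lt_div_iff₀ hD]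
    constructor <;> rintro ⟨h₁, h₂⟩ <;> constructor <;> linarith
  have hfixed : {ω | 0 ≤ Θ ω * Pd - Ts * CB ∧ Θ ω * PA - Tr * CB ≤ Θ ω * Pd - Ts * CB} =
      Θ ⁻¹' Set.Ici ((Ts - Tr) * CB / (Pd - PA)) := by
    ext ω
    simp only [Set.mem_ofPred_eq, Set.mem_preimage, Set.mem_Ici]
    constructor
    · rintro ⟨-, h⟩
      rw [div_le_iff₀ hD]
      linarith
    · intro h
      have hc := (div_le_iff₀ (hPA.trans hPd)).1 (hcb.trans h)
      rw [div_le_iff₀ hD] at h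
      constructor <;> linarith
  have hexpA : -(CB * Tr) / (θb * PA) = -(1 / θb * (Tr * CB / PA)) := by
    field_simp
  have hexpB : -(CB * (Ts - Tr)) / (θb * (Pd - PA)) =
      -(1 / θb * ((Ts - Tr) * CB / (Pd - PA))) := by
    field_simp
  rw [hregulation, hfixed, ← Measure.map_apply hΘ measurableSet_Ico,
    ← Measure.map_apply hΘ measurableSet_Ici, hlaw, hexpA, hexpB]
  exact ⟨expMeasure_Ico hr ha hab, expMeasure_Ici hr (ha.trans hab)⟩
end
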